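/- Let p = rururrur (which is depth-zero, of dimensions 5×3, with exactly two bifixes rur and r). Then for all integers m ≥ n ≥ 0, in ℚ: s_p(n, m) = (m − n + 1) · Σ_{i=0}^{n} Σ_{j ≥ 0} Σ_{k ≥ 0} C(i, j) · G(−i, k) · C(k, n − i − 3j − 3k) · (1/(m − n + i + j + k + 1)) · C(m − n + 2i + j + k, i), where C(·,·) denotes the usual binomial coefficient (equal to 0 when the lower argument is negative or exceeds a nonnegative upper argument), G(−i, k) := (−1)^k · C(i + k − 1, k) is the generalized binomial coefficient with negative upper argument (with G(0,0) = 1 and G(0,k) = 0 for k ≥ 1), and the inner sums have only finitely many nonzero terms. -/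

import Mathlib

/-- A step of a lattice path: `u` (up) or `r` (right). -/
inductive Step : Type
  | u : Step
  | r : Step
deriving DecidableEq

/-- A word over the alphabet `{u, r}`. -/
abbrev Word := List Step

/-- The number of letters `r` in a word. -/
def countR (w : Word) : ℕ := w.count Step.r

/-- The number of letters `u` in a word. -/
def countU (w : Word) : ℕ := w.count Step.u

/-- `dval q` = (number of `r`'s in `q`) - (number of `u`'s in `q`). -/
def dval (w : Word) : ℤ := (countR w : ℤ) - (countU w : ℤ)

/-- A pattern is depth-zero if every suffix `q` of it satisfies `dval q ≥ 0`. -/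
def DepthZero (p : Word) : Prop := ∀ q : Word, q <:+ p → 0 ≤ dval q

/-- `o` is a bifix of `p`: a nonempty proper prefix of `p` that is also a (proper) suffix. -/
def IsBifix (o p : Word) : Prop := o ≠ [] ∧ o ≠ p ∧ o <+: p ∧ o <:+ p

/-- A pattern is bifix-free if it has no bifix. -/
def BifixFree (p : Word) : Prop := ∀ o : Word, ¬ IsBifix o p

/-- `w` is a ballot path to the lattice point `(n, m)`: it has exactly `n` letters `r`
and `m` letters `u`, and every prefix has at least as many `u`'s as `r`'s. -/
def IsBallot (w : Word) (n m : ℤ) : Prop :=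
  (countR w : ℤ) = n ∧ (countU w : ℤ) = m ∧
    ∀ t : Word, t <+: w → countR t ≤ countU t

/-- `w` avoids the pattern `p`: `p` does not occur in `w` as a contiguous substring. -/
def Avoids (p w : Word) : Prop := ¬ p <:+: w

/-- `s p n m` is the number of ballot paths to `(n, m)` avoiding `p`
(`0` if `n < 0`, `m < 0`, or `m < n`, since then no such path exists). -/
noncomputable def s (p : Word) (n m : ℤ) : ℕ :=
  Set.ncard {w : Word | IsBallot w n m ∧ Avoids p w}

/-- The pattern `rururrur`. -/
def rururrur : Word :=
  [Step.r, Step.u, Step.r, Step.u, Step.r, Step.r, Step.u, Step.r]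

theorem isBallot_concat (w : Word) (c : Step) (n m : ℤ) :
    IsBallot (w ++ [c]) n m ↔
      IsBallot w (n - if c = Step.r then 1 else 0) (m - if c = Step.u then 1 else 0) ∧
        n ≤ m := by
  unfold IsBallot countR countU
  constructor
  · rintro ⟨h1, h2, h3⟩
    have h4 := h3 _ (List.prefix_refl _)
    refine ⟨⟨?_, ?_, fun t ht => h3 t (ht.trans (List.prefix_append _ _))⟩, by omega⟩
    · cases c <;> simp [List.count_append] at h1 ⊢ <;> omega
    · cases c <;> simp [List.count_append] at h2 ⊢ <;> omega
  · rintro ⟨⟨h1, h2, h3⟩, h4⟩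
    have h5 : ((List.count Step.r (w ++ [c]) : ℕ) : ℤ) = n := by
      cases c <;> simp [List.count_append] at h1 ⊢ <;> omega
    have h6 : ((List.count Step.u (w ++ [c]) : ℕ) : ℤ) = m := by
      cases c <;> simp [List.count_append] at h2 ⊢ <;> omega
    refine ⟨h5, h6, fun t ht => ?_⟩
    rcases List.prefix_concat_iff.1 ht with rfl | ht
    · omega
    · exact h3 t ht

theorem avoids_concat (p w : Word) (c : Step) :
    Avoids p (w ++ [c]) ↔ Avoids p w ∧ ¬ p <:+ w ++ [c] := by
  unfold Avoids
  rw [List.infix_concat_iff]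
  tauto

theorem IsBallot.length_eq {w : Word} {n m : ℤ} (h : IsBallot w n m) :
    (w.length : ℤ) = n + m := by
  have : ∀ w : Word, w.count Step.r + w.count Step.u = w.length := by
    intro w
    induction w with
    | nil => rfl
    | cons a l ih => cases a <;> simp <;> omega
  obtain ⟨h1, h2, -⟩ := h
  rw [← h1, ← h2, ← this w]
  rfl

theorem finite_setOf_isBallot (n m : ℤ) : {w : Word | IsBallot w n m}.Finite := by
  have : Finite Step := Finite.of_injective (β := Bool) (fun a => decide (a = Step.u)) (by
    intro a b; cases a <;> cases b <;> simp)
  refine (List.finite_length_eq Step (n + m).toNat).subset fun w hw => ?_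
  have := hw.length_eq
  simp only [Set.mem_ofPred_eq]
  omega

/-- Ballot paths to `(n, m)` avoiding `p`. -/
def avoidingPaths (p : Word) (n m : ℤ) : Set Word := {w | IsBallot w n m ∧ Avoids p w}

/-- Ballot paths `w` to `(n, m)` such that `w` followed by `rururrur` contains `rururrur` only at
its end. -/
def firstHitPaths (n m : ℤ) : Set Word :=
  {w | IsBallot w n m ∧
    Avoids rururrur (w ++ [Step.r, Step.u, Step.r, Step.u, Step.r, Step.r, Step.u])}

theorem finite_avoidingPaths (p : Word) (n m : ℤ) : (avoidingPaths p n m).Finite :=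
  (finite_setOf_isBallot n m).subset fun _ h => h.1

theorem finite_firstHitPaths (n m : ℤ) : (firstHitPaths n m).Finite :=
  (finite_setOf_isBallot n m).subset fun _ h => h.1

theorem append_left_injective (q : Word) : Function.Injective (fun w : Word => w ++ q) :=
  fun _ _ h => List.append_cancel_right h

theorem suffix_iff_reverse_prefix (p w : Word) : p <:+ w ↔ p.reverse <+: w.reverse :=
  List.reverse_prefix.symm

theorem avoids_append_rurur (v : Word) :
    Avoids rururrur (v ++ [Step.r, Step.u, Step.r, Step.u, Step.r]) ↔
      Avoids rururrur (v ++ [Step.r, Step.u, Step.r, Step.u, Step.r, Step.r, Step.u]) := by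
  have h : v ++ [Step.r, Step.u, Step.r, Step.u, Step.r, Step.r, Step.u] =
    v ++ [Step.r, Step.u, Step.r, Step.u, Step.r] ++ [Step.r] ++ [Step.u] := by simp
  rw [h, avoids_concat, avoids_concat]
  simp [suffix_iff_reverse_prefix, rururrur]

theorem avoids_append_rururru (v : Word) :
    Avoids rururrur (v ++ [Step.r, Step.u, Step.r, Step.u, Step.r, Step.r, Step.u]) ↔
      Avoids rururrur v ∧ ¬ [Step.r, Step.u, Step.r, Step.u, Step.r, Step.r, Step.u] <:+ v ∧
        ¬ [Step.r, Step.u, Step.r, Step.u, Step.r] <:+ v := by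
  have h : v ++ [Step.r, Step.u, Step.r, Step.u, Step.r, Step.r, Step.u] =
    v ++ [Step.r] ++ [Step.u] ++ [Step.r] ++ [Step.u] ++ [Step.r] ++ [Step.r] ++ [Step.u] := by
    simp
  rw [h]
  simp only [avoids_concat, and_assoc]
  simp [suffix_iff_reverse_prefix, rururrur]

theorem avoidingPaths_eq_union (n m : ℤ) (h : n + 2 ≤ m) :
    avoidingPaths rururrur n m = firstHitPaths n m ∪
      ((fun w : Word => w ++ [Step.r, Step.u, Step.r, Step.u, Step.r]) ''
          firstHitPaths (n - 3) (m - 2) ∪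
        (fun w : Word => w ++ [Step.r, Step.u, Step.r, Step.u, Step.r, Step.r, Step.u]) ''
          firstHitPaths (n - 4) (m - 3)) := by
  have h5 (v : Word) : IsBallot (v ++ [Step.r, Step.u, Step.r, Step.u, Step.r]) n m ↔
      IsBallot v (n - 3) (m - 2) := by
    have e : v ++ [Step.r, Step.u, Step.r, Step.u, Step.r] =
      v ++ [Step.r] ++ [Step.u] ++ [Step.r] ++ [Step.u] ++ [Step.r] := by simp
    rw [e]
    simp only [isBallot_concat, reduceCtorEq, if_true, if_false]
    ring_nf
    constructor
    · tauto
    · intro h; refine ⟨⟨⟨⟨⟨h, ?_⟩, ?_⟩, ?_⟩, ?_⟩, ?_⟩ <;> omega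
  have h7 (v : Word) :
      IsBallot (v ++ [Step.r, Step.u, Step.r, Step.u, Step.r, Step.r, Step.u]) n m ↔
      IsBallot v (n - 4) (m - 3) := by
    have e : v ++ [Step.r, Step.u, Step.r, Step.u, Step.r, Step.r, Step.u] =
      v ++ [Step.r] ++ [Step.u] ++ [Step.r] ++ [Step.u] ++ [Step.r] ++ [Step.r] ++ [Step.u] := by
      simp
    rw [e]
    simp only [isBallot_concat, reduceCtorEq, if_true, if_false]
    ring_nf
    constructor
    · tauto
    · intro h; refine ⟨⟨⟨⟨⟨⟨⟨h, ?_⟩, ?_⟩, ?_⟩, ?_⟩, ?_⟩, ?_⟩, ?_⟩ <;> omega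
  ext w
  constructor
  · rintro ⟨hb, ha⟩
    by_cases h1 : [Step.r, Step.u, Step.r, Step.u, Step.r, Step.r, Step.u] <:+ w
    · obtain ⟨v, rfl⟩ := h1
      exact Or.inr (Or.inr ⟨v, ⟨(h7 v).1 hb, ha⟩, rfl⟩)
    by_cases h2 : [Step.r, Step.u, Step.r, Step.u, Step.r] <:+ w
    · obtain ⟨v, rfl⟩ := h2
      exact Or.inr (Or.inl ⟨v, ⟨(h5 v).1 hb, (avoids_append_rurur v).1 ha⟩, rfl⟩)
    exact Or.inl ⟨hb, (avoids_append_rururru w).2 ⟨ha, h1, h2⟩⟩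
  · rintro (⟨hb, ha⟩ | ⟨v, ⟨hb, ha⟩, rfl⟩ | ⟨v, ⟨hb, ha⟩, rfl⟩)
    · exact ⟨hb, ((avoids_append_rururru w).1 ha).1⟩
    · exact ⟨(h5 v).2 hb, (avoids_append_rurur v).2 ha⟩
    · exact ⟨(h7 v).2 hb, ha⟩

/-- Splitting the avoiding paths by the first occurrence of `rururrur` created by appending it. -/
theorem s_eq_ncard_firstHitPaths_add (n m : ℤ) (h : n + 2 ≤ m) :
    s rururrur n m = (firstHitPaths n m).ncard +
      (firstHitPaths (n - 3) (m - 2)).ncard + (firstHitPaths (n - 4) (m - 3)).ncard := by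
  change (avoidingPaths rururrur n m).ncard = _
  rw [avoidingPaths_eq_union n m h, Set.ncard_union_eq ?_ (finite_firstHitPaths _ _)
    (((finite_firstHitPaths _ _).image _).union ((finite_firstHitPaths _ _).image _)),
    Set.ncard_union_eq ?_ ((finite_firstHitPaths _ _).image _)
      ((finite_firstHitPaths _ _).image _),
    Set.ncard_image_of_injective _ (append_left_injective _),
    Set.ncard_image_of_injective _ (append_left_injective _), add_assoc]
  · rw [Set.disjoint_left]
    rintro _ ⟨v, -, rfl⟩ ⟨v', -, h'⟩
    have := congrArg List.reverse h'
    simp at this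
  · rw [Set.disjoint_left]
    rintro _ ⟨-, h2⟩ (⟨v, -, rfl⟩ | ⟨v, -, rfl⟩)
    · exact ((avoids_append_rururru _).1 h2).2.2 ⟨v, rfl⟩
    · exact ((avoids_append_rururru _).1 h2).2.1 ⟨v, rfl⟩

theorem avoidingPaths_union_eq (n m : ℤ) (h : n ≤ m) (h0 : ¬ (n = 0 ∧ m = 0)) :
    avoidingPaths rururrur n m ∪ (fun w : Word => w ++ rururrur) '' firstHitPaths (n - 5) (m - 3) =
      (fun w : Word => w ++ [Step.u]) '' avoidingPaths rururrur n (m - 1) ∪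
        (fun w : Word => w ++ [Step.r]) '' avoidingPaths rururrur (n - 1) m := by
  have h8 (v : Word) : v ++ rururrur =
      v ++ [Step.r, Step.u, Step.r, Step.u, Step.r, Step.r, Step.u] ++ [Step.r] := by
    simp [rururrur]
  have hb8 (v : Word) :
      IsBallot (v ++ [Step.r, Step.u, Step.r, Step.u, Step.r, Step.r, Step.u]) (n - 1) m ↔
      IsBallot v (n - 5) (m - 3) := by
    have e : v ++ [Step.r, Step.u, Step.r, Step.u, Step.r, Step.r, Step.u] =
      v ++ [Step.r] ++ [Step.u] ++ [Step.r] ++ [Step.u] ++ [Step.r] ++ [Step.r] ++ [Step.u] := by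
      simp
    rw [e]
    simp only [isBallot_concat, reduceCtorEq, if_true, if_false]
    ring_nf
    constructor
    · tauto
    · intro h; refine ⟨⟨⟨⟨⟨⟨⟨h, ?_⟩, ?_⟩, ?_⟩, ?_⟩, ?_⟩, ?_⟩, ?_⟩ <;> omega
  ext w
  constructor
  · rintro (⟨hb, ha⟩ | ⟨v, ⟨hb, ha⟩, rfl⟩)
    · rcases List.eq_nil_or_concat' w with rfl | ⟨v, c, rfl⟩
      · exact absurd ⟨by simpa [countR] using hb.1.symm, by simpa [countU] using hb.2.1.symm⟩ h0
      · rw [isBallot_concat] at hb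
        rw [avoids_concat] at ha
        cases c
        · exact Or.inl ⟨v, ⟨by simpa using hb.1, ha.1⟩, rfl⟩
        · exact Or.inr ⟨v, ⟨by simpa using hb.1, ha.1⟩, rfl⟩
    · exact Or.inr ⟨_, ⟨(hb8 v).2 hb, ha⟩, (h8 v).symm⟩
  · rintro (⟨v, ⟨hb, ha⟩, rfl⟩ | ⟨v, ⟨hb, ha⟩, rfl⟩)
    · refine Or.inl ⟨(isBallot_concat _ _ _ _).2 ⟨by simpa using hb, h⟩,
        (avoids_concat _ _ _).2 ⟨ha, ?_⟩⟩
      simp [suffix_iff_reverse_prefix, rururrur]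
    · by_cases hs : rururrur <:+ v ++ [Step.r]
      · obtain ⟨v', hv'⟩ := hs
        rw [h8] at hv'
        obtain rfl := List.append_cancel_right hv'
        exact Or.inr ⟨v', ⟨(hb8 v').1 hb, ha⟩, h8 v'⟩
      · exact Or.inl ⟨(isBallot_concat _ _ _ _).2 ⟨by simpa using hb, h⟩,
          (avoids_concat _ _ _).2 ⟨ha, hs⟩⟩

/-- Splitting a path at its last step. -/
theorem s_add_ncard_firstHitPaths (n m : ℤ) (h : n ≤ m) (h0 : ¬ (n = 0 ∧ m = 0)) :
    s rururrur n m + (firstHitPaths (n - 5) (m - 3)).ncard =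
      s rururrur n (m - 1) + s rururrur (n - 1) m := by
  change (avoidingPaths rururrur n m).ncard + _ =
    (avoidingPaths rururrur n (m - 1)).ncard + (avoidingPaths rururrur (n - 1) m).ncard
  have key := congrArg Set.ncard (avoidingPaths_union_eq n m h h0)
  rwa [Set.ncard_union_eq ?_ (finite_avoidingPaths _ _ _) ((finite_firstHitPaths _ _).image _),
    Set.ncard_union_eq ?_ ((finite_avoidingPaths _ _ _).image _)
      ((finite_avoidingPaths _ _ _).image _),
    Set.ncard_image_of_injective _ (append_left_injective _),
    Set.ncard_image_of_injective _ (append_left_injective _),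
    Set.ncard_image_of_injective _ (append_left_injective _)] at key
  · rw [Set.disjoint_left]
    rintro _ ⟨v, -, rfl⟩ ⟨v', -, h'⟩
    have := congrArg List.reverse h'
    simp at this
  · rw [Set.disjoint_left]
    rintro _ ⟨-, h2⟩ ⟨v, -, rfl⟩
    exact h2 (List.suffix_append _ _).isInfix

theorem s_eq_zero (p : Word) (n m : ℤ) (h : n < 0 ∨ m < n) : s p n m = 0 := by
  have : {w : Word | IsBallot w n m ∧ Avoids p w} = ∅ := by
    ext w
    simp only [Set.mem_ofPred_eq, Set.mem_empty_iff_false, iff_false, not_and]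
    intro hb
    have h3 := hb.2.2 w (List.prefix_refl _)
    have h1 := hb.1
    have h2 := hb.2.1
    omega
  rw [s, this, Set.ncard_empty]

theorem s_zero_zero : s rururrur 0 0 = 1 := by
  have : {w : Word | IsBallot w 0 0 ∧ Avoids rururrur w} = {[]} := by
    ext w
    simp only [Set.mem_ofPred_eq, Set.mem_singleton_iff]
    constructor
    · intro hw
      have := hw.1.length_eq
      exact List.length_eq_zero_iff.1 (by omega)
    · rintro rfl
      simp [IsBallot, Avoids, countR, countU, rururrur]
  rw [s, this, Set.ncard_singleton]

theorem ncard_firstHitPaths_of_neg (n m : ℤ) (h : n < 0) : (firstHitPaths n m).ncard = 0 := by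
  have : firstHitPaths n m = ∅ := by
    ext w
    simp only [firstHitPaths, Set.mem_ofPred_eq, Set.mem_empty_iff_false, iff_false, not_and]
    intro hb
    have h1 := hb.1
    omega
  rw [this, Set.ncard_empty]

/-- The number of avoiding paths ending on the diagonal `m = n + x - 1`, extended by the value `1`
at `n = x = 0`. -/
noncomputable def diagCount (n : ℤ) (x : ℕ) : ℚ :=
  s rururrur n (n + x - 1) + if n = 0 ∧ x = 0 then 1 else 0

theorem ncard_firstHitPaths_eq (n : ℤ) (x : ℕ) :
    ((firstHitPaths (n - 5) (n + x - 3)).ncard : ℚ) =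
      diagCount n x + diagCount (n - 1) (x + 2) - diagCount n (x + 1) := by
  unfold diagCount
  by_cases h0 : n = 0 ∧ x = 0
  · obtain ⟨rfl, rfl⟩ := h0
    rw [ncard_firstHitPaths_of_neg _ _ (by norm_num)]
    simp [s_zero_zero, s_eq_zero]
  · have := s_add_ncard_firstHitPaths n (n + x) (by omega) (by omega)
    have e1 : n - 1 + ((x + 2 : ℕ) : ℤ) - 1 = n + x := by push_cast; ring
    have e2 : n + ((x + 1 : ℕ) : ℤ) - 1 = n + x := by push_cast; ring
    rw [e1, e2, if_neg h0, if_neg (by omega), if_neg (by omega)]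
    have h' : (s rururrur n (n + x) : ℚ) + ((firstHitPaths (n - 5) (n + x - 3)).ncard : ℚ) =
      s rururrur n (n + x - 1) + s rururrur (n - 1) (n + x) := by exact_mod_cast this
    linarith

theorem diagCount_recurrence (n : ℤ) (x : ℕ) :
    diagCount n (x + 1) - diagCount n x +
      (diagCount (n - 3) (x + 2) - diagCount (n - 3) (x + 1)) +
      (diagCount (n - 4) (x + 2) - diagCount (n - 4) (x + 1)) =
    diagCount (n - 1) (x + 2) + diagCount (n - 4) (x + 3) := by
  have h1 := ncard_firstHitPaths_eq n x
  have h2 := ncard_firstHitPaths_eq (n - 3) (x + 1)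
  have h3 := ncard_firstHitPaths_eq (n - 4) (x + 1)
  have h4 : diagCount (n - 5) (x + 3) = (firstHitPaths (n - 5) (n + x - 3)).ncard +
      (firstHitPaths (n - 3 - 5) (n - 3 + (x + 1 : ℕ) - 3)).ncard +
      (firstHitPaths (n - 4 - 5) (n - 4 + (x + 1 : ℕ) - 3)).ncard := by
    have := s_eq_ncard_firstHitPaths_add (n - 5) (n + x - 3) (by omega)
    have e1 : n - 3 - 5 = n - 5 - 3 := by ring
    have e2 : n - 4 - 5 = n - 5 - 4 := by ring
    have e3 : n - 3 + ((x + 1 : ℕ) : ℤ) - 3 = n + x - 3 - 2 := by push_cast; ring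
    have e4 : n - 4 + ((x + 1 : ℕ) : ℤ) - 3 = n + x - 3 - 3 := by push_cast; ring
    have e5 : n - 5 + ((x + 3 : ℕ) : ℤ) - 1 = n + x - 3 := by push_cast; ring
    rw [diagCount, e1, e2, e3, e4, e5, this, if_neg (by omega)]
    push_cast
    ring
  have e1 : n - 3 - 1 = n - 4 := by ring
  have e2 : n - 4 - 1 = n - 5 := by ring
  rw [e1] at h2
  rw [e2] at h3
  simp only [add_assoc, Nat.reduceAdd] at h1 h2 h3 h4 ⊢
  linarith

theorem diagCount_zero (n : ℤ) : diagCount n 0 = if n = 0 then 1 else 0 := by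
  simp [diagCount, s_eq_zero]

theorem diagCount_of_neg (n : ℤ) (x : ℕ) (h : n < 0) : diagCount n x = 0 := by
  rw [diagCount, s_eq_zero _ _ _ (Or.inl h), if_neg (by omega)]
  simp

/-- The diagonal recurrence has at most one solution with given values at `x = 0`. -/
theorem eq_of_diag_recurrence (f g : ℤ → ℕ → ℚ)
    (hf : ∀ n x, f n (x + 1) - f n x + (f (n - 3) (x + 2) - f (n - 3) (x + 1)) +
      (f (n - 4) (x + 2) - f (n - 4) (x + 1)) = f (n - 1) (x + 2) + f (n - 4) (x + 3))
    (hg : ∀ n x, g n (x + 1) - g n x + (g (n - 3) (x + 2) - g (n - 3) (x + 1)) +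
      (g (n - 4) (x + 2) - g (n - 4) (x + 1)) = g (n - 1) (x + 2) + g (n - 4) (x + 3))
    (hneg : ∀ n x, n < 0 → f n x = g n x) (h0 : ∀ n, f n 0 = g n 0) (n : ℤ) (x : ℕ) :
    f n x = g n x := by
  have main : ∀ N : ℕ, ∀ n : ℤ, n < N → ∀ x, f n x = g n x := by
    intro N
    induction N with
    | zero => exact fun n hn x => hneg n x (by simpa using hn)
    | succ N ih =>
      intro n hn x
      induction x with
      | zero => exact h0 n
      | succ x ihx =>
        have e1 := hf n x
        have e2 := hg n x
        have l1 := ih (n - 1) (by push_cast at hn; omega)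
        have l3 := ih (n - 3) (by push_cast at hn; omega)
        have l4 := ih (n - 4) (by push_cast at hn; omega)
        simp only [l1, l3, l4, ihx] at e1
        linarith
  exact main (n.toNat + 1) n (by omega) x

/-- The coefficient of `w ^ i` in a power series in `t` over `ℚ[w]`. -/
noncomputable def coeffSlice (i : ℕ) : PowerSeries (Polynomial ℚ) →ₗ[ℚ] PowerSeries ℚ where
  toFun f := PowerSeries.mk fun n => (PowerSeries.coeff n f).coeff i
  map_add' f g := by ext n; simp
  map_smul' c f := by ext n; simp

theorem coeff_coeffSlice (i n : ℕ) (f : PowerSeries (Polynomial ℚ)) :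
    PowerSeries.coeff n (coeffSlice i f) = (PowerSeries.coeff n f).coeff i := by
  simp [coeffSlice]

theorem coeffSlice_X_pow_mul (i k : ℕ) (f : PowerSeries (Polynomial ℚ)) :
    coeffSlice i (PowerSeries.X ^ k * f) = PowerSeries.X ^ k * coeffSlice i f := by
  ext n
  rw [coeff_coeffSlice, PowerSeries.coeff_X_pow_mul', PowerSeries.coeff_X_pow_mul']
  split_ifs <;> simp [coeff_coeffSlice]

theorem coeffSlice_succ_C_X_mul (i : ℕ) (f : PowerSeries (Polynomial ℚ)) :
    coeffSlice (i + 1) (PowerSeries.C Polynomial.X * f) = coeffSlice i f := by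
  ext n
  simp [coeff_coeffSlice]

theorem coeffSlice_zero_C_X_mul (f : PowerSeries (Polynomial ℚ)) :
    coeffSlice 0 (PowerSeries.C Polynomial.X * f) = 0 := by
  ext n
  simp [coeff_coeffSlice]

theorem coeffSlice_C (i : ℕ) (q : Polynomial ℚ) :
    coeffSlice i (PowerSeries.C q) = PowerSeries.C (q.coeff i) := by
  ext n
  rw [coeff_coeffSlice, PowerSeries.coeff_C, PowerSeries.coeff_C]
  split_ifs <;> simp

/-- Coefficientwise derivative with respect to `w` of power series in `t` over `ℚ[w]`. -/
noncomputable def coeffDerivation :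
    Derivation ℚ (PowerSeries (Polynomial ℚ)) (PowerSeries (Polynomial ℚ)) :=
  Derivation.mk'
    { toFun := fun f => PowerSeries.mk fun n => Polynomial.derivative (PowerSeries.coeff n f)
      map_add' := fun f g => by ext1 n; simp
      map_smul' := fun c f => by ext1 n; simp }
    (fun f g => by
      ext1 n
      simp only [LinearMap.coe_mk, AddHom.coe_mk, PowerSeries.coeff_mk, PowerSeries.coeff_mul,
        smul_eq_mul, map_add, Polynomial.derivative_sum, Polynomial.derivative_mul,
        Finset.sum_add_distrib]
      rw [add_comm]
      congr 1
      rw [← Finset.Nat.sum_antidiagonal_swap]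
      exact Finset.sum_congr rfl fun p _ => mul_comm _ _)

theorem coeff_coeffDerivation (n : ℕ) (f : PowerSeries (Polynomial ℚ)) :
    PowerSeries.coeff n (coeffDerivation f) = Polynomial.derivative (PowerSeries.coeff n f) := by
  simp [coeffDerivation]

theorem coeffDerivation_X : coeffDerivation PowerSeries.X = 0 := by
  ext1 n
  rw [coeff_coeffDerivation, PowerSeries.coeff_X]
  split_ifs <;> simp

theorem coeffDerivation_C (q : Polynomial ℚ) :
    coeffDerivation (PowerSeries.C q) = PowerSeries.C (Polynomial.derivative q) := by
  ext1 n
  rw [coeff_coeffDerivation, PowerSeries.coeff_C, PowerSeries.coeff_C]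
  split_ifs <;> simp

/-- The Lagrange functional `H ↦ [w ^ i] H φ ^ (i - 1) (φ - w ∂φ)`. -/
noncomputable def lagrangeCoeff (φ H : PowerSeries (Polynomial ℚ)) : ℕ → PowerSeries ℚ
  | 0 => coeffSlice 0 H
  | i + 1 => coeffSlice (i + 1)
      (H * φ ^ i * (φ - PowerSeries.C Polynomial.X * coeffDerivation φ))

theorem lagrangeCoeff_zero_C_X_mul (φ H : PowerSeries (Polynomial ℚ)) :
    lagrangeCoeff φ (PowerSeries.C Polynomial.X * H) 0 = 0 :=
  coeffSlice_zero_C_X_mul H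

theorem lagrangeCoeff_succ_C_X_mul (φ H : PowerSeries (Polynomial ℚ)) (i : ℕ) :
    lagrangeCoeff φ (PowerSeries.C Polynomial.X * H) (i + 1) = lagrangeCoeff φ (φ * H) i := by
  cases i with
  | zero =>
    simp only [lagrangeCoeff]
    rw [mul_assoc, mul_assoc, coeffSlice_succ_C_X_mul, pow_zero, one_mul, mul_sub, map_sub,
      mul_left_comm H, coeffSlice_zero_C_X_mul, sub_zero, mul_comm]
  | succ i =>
    simp only [lagrangeCoeff]
    rw [mul_assoc, mul_assoc, coeffSlice_succ_C_X_mul]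
    congr 1
    ring

theorem lagrangeCoeff_add (φ H K : PowerSeries (Polynomial ℚ)) (i : ℕ) :
    lagrangeCoeff φ (H + K) i = lagrangeCoeff φ H i + lagrangeCoeff φ K i := by
  cases i <;> simp [lagrangeCoeff, add_mul]

theorem lagrangeCoeff_sub (φ H K : PowerSeries (Polynomial ℚ)) (i : ℕ) :
    lagrangeCoeff φ (H - K) i = lagrangeCoeff φ H i - lagrangeCoeff φ K i := by
  cases i <;> simp [lagrangeCoeff, sub_mul]

theorem lagrangeCoeff_X_pow_mul (φ H : PowerSeries (Polynomial ℚ)) (k i : ℕ) :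
    lagrangeCoeff φ (PowerSeries.X ^ k * H) i = PowerSeries.X ^ k * lagrangeCoeff φ H i := by
  cases i <;> simp [lagrangeCoeff, mul_assoc, coeffSlice_X_pow_mul]

theorem lagrangeCoeff_succ (φ H : PowerSeries (Polynomial ℚ)) (i : ℕ) :
    ((i : ℚ) + 1) • lagrangeCoeff φ H (i + 1) = coeffSlice (i + 1)
      (H * (((i : ℚ) + 1) • φ ^ (i + 1) -
        PowerSeries.C Polynomial.X * coeffDerivation (φ ^ (i + 1)))) := by
  rw [lagrangeCoeff, ← map_smul, Derivation.leibniz_pow]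
  congr 1
  have : ((i : ℚ) + 1) = ((i + 1 : ℕ) : ℚ) := by push_cast; rfl
  rw [this, Nat.cast_smul_eq_nsmul, Nat.cast_smul_eq_nsmul]
  simp only [nsmul_eq_mul, smul_eq_mul, Nat.add_sub_cancel]
  ring

/-- The truncated Lagrange series `∑ i ≤ N, t ^ i [w ^ i] H φ ^ (i - 1) (φ - w ∂φ)`. -/
noncomputable def lagrangeSum (φ : PowerSeries (Polynomial ℚ)) (N : ℕ)
    (H : PowerSeries (Polynomial ℚ)) : PowerSeries ℚ :=
  ∑ i ∈ Finset.range (N + 1), PowerSeries.X ^ i * lagrangeCoeff φ H i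

theorem lagrangeSum_succ_C_X_mul (φ H : PowerSeries (Polynomial ℚ)) (N : ℕ) :
    lagrangeSum φ (N + 1) (PowerSeries.C Polynomial.X * H) =
      PowerSeries.X * lagrangeSum φ N (φ * H) := by
  rw [lagrangeSum, Finset.sum_range_succ', lagrangeCoeff_zero_C_X_mul, mul_zero, add_zero,
    lagrangeSum, Finset.mul_sum]
  refine Finset.sum_congr rfl fun i _ => ?_
  rw [lagrangeCoeff_succ_C_X_mul, pow_succ']
  ring

theorem lagrangeSum_add (φ H K : PowerSeries (Polynomial ℚ)) (N : ℕ) :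
    lagrangeSum φ N (H + K) = lagrangeSum φ N H + lagrangeSum φ N K := by
  simp [lagrangeSum, lagrangeCoeff_add, mul_add, Finset.sum_add_distrib]

theorem lagrangeSum_sub (φ H K : PowerSeries (Polynomial ℚ)) (N : ℕ) :
    lagrangeSum φ N (H - K) = lagrangeSum φ N H - lagrangeSum φ N K := by
  simp [lagrangeSum, lagrangeCoeff_sub, mul_sub, Finset.sum_sub_distrib]

theorem lagrangeSum_X_pow_mul (φ H : PowerSeries (Polynomial ℚ)) (N k : ℕ) :
    lagrangeSum φ N (PowerSeries.X ^ k * H) = PowerSeries.X ^ k * lagrangeSum φ N H := by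
  simp [lagrangeSum, lagrangeCoeff_X_pow_mul, Finset.mul_sum, mul_left_comm]

theorem coeff_lagrangeSum (φ H : PowerSeries (Polynomial ℚ)) (N n : ℕ) (h : n ≤ N) :
    PowerSeries.coeff n (lagrangeSum φ N H) =
      ∑ i ∈ Finset.range (n + 1), PowerSeries.coeff (n - i) (lagrangeCoeff φ H i) := by
  rw [lagrangeSum, map_sum]
  symm
  have hsub : Finset.range (n + 1) ⊆ Finset.range (N + 1) :=
    Finset.range_subset_range.2 (by omega)
  rw [← Finset.sum_subset hsub]
  · refine Finset.sum_congr rfl fun i hi => ?_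
    rw [PowerSeries.coeff_X_pow_mul', if_pos (by simpa [Nat.lt_succ_iff] using hi)]
  · intro i _ hi
    rw [PowerSeries.coeff_X_pow_mul', if_neg (by simpa [Nat.lt_succ_iff] using hi)]

/-- The coefficient of `t ^ n` in the Lagrange series of `H`, zero for negative `n`. -/
noncomputable def lagrangeEntry (φ H : PowerSeries (Polynomial ℚ)) (n : ℤ) : ℚ :=
  if n < 0 then 0 else PowerSeries.coeff n.toNat (lagrangeSum φ n.toNat H)

theorem coeff_X_pow_mul_lagrangeSum (φ H : PowerSeries (Polynomial ℚ)) (N n k : ℕ)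
    (h : n ≤ N + k) :
    PowerSeries.coeff n (PowerSeries.X ^ k * lagrangeSum φ N H) =
      lagrangeEntry φ H ((n : ℤ) - k) := by
  rw [PowerSeries.coeff_X_pow_mul', lagrangeEntry]
  by_cases hk : k ≤ n
  · have e : ((n : ℤ) - k).toNat = n - k := by omega
    rw [if_pos hk, if_neg (by omega), e, coeff_lagrangeSum _ _ _ _ (by omega),
      coeff_lagrangeSum _ _ _ _ le_rfl]
  · rw [if_neg hk, if_pos (by omega)]

/-- The element `1 + w`. -/
noncomputable def onePlusW : PowerSeries (Polynomial ℚ) := PowerSeries.C (1 + Polynomial.X)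

/-- The series `(1 + (t ^ 3 + t ^ 4) (1 + w))⁻¹`. -/
noncomputable def clusterInv : PowerSeries (Polynomial ℚ) :=
  PowerSeries.invOfUnit (1 + (PowerSeries.X ^ 3 + PowerSeries.X ^ 4) * onePlusW) 1

theorem mul_clusterInv :
    (1 + (PowerSeries.X ^ 3 + PowerSeries.X ^ 4) * onePlusW) * clusterInv = 1 :=
  PowerSeries.mul_invOfUnit _ _ (by simp)

/-- The Lagrange kernel `φ` of the pattern `rururrur`: the generating function `1 + w` of avoiding
paths along a diagonal solves `w = t φ(w)`. -/
noncomputable def ballotKernel : PowerSeries (Polynomial ℚ) :=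
  onePlusW ^ 2 * (1 + PowerSeries.X ^ 3 * onePlusW) * clusterInv

theorem lagrangeSum_ballotKernel_recurrence (N x : ℕ) :
    lagrangeSum ballotKernel (N + 1) (onePlusW ^ (x + 1)) -
      lagrangeSum ballotKernel (N + 1) (onePlusW ^ x) +
      (PowerSeries.X ^ 3 * lagrangeSum ballotKernel (N + 1) (onePlusW ^ (x + 2)) -
        PowerSeries.X ^ 3 * lagrangeSum ballotKernel (N + 1) (onePlusW ^ (x + 1))) +
      (PowerSeries.X ^ 4 * lagrangeSum ballotKernel (N + 1) (onePlusW ^ (x + 2)) -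
        PowerSeries.X ^ 4 * lagrangeSum ballotKernel (N + 1) (onePlusW ^ (x + 1))) =
    PowerSeries.X ^ 1 * lagrangeSum ballotKernel N (onePlusW ^ (x + 2)) +
      PowerSeries.X ^ 4 * lagrangeSum ballotKernel N (onePlusW ^ (x + 3)) := by
  have hw : PowerSeries.C Polynomial.X = onePlusW - 1 := by simp [onePlusW]
  have key := lagrangeSum_succ_C_X_mul ballotKernel
    (onePlusW ^ x * (1 + (PowerSeries.X ^ 3 + PowerSeries.X ^ 4) * onePlusW)) N
  have e1 : PowerSeries.C Polynomial.X *
      (onePlusW ^ x * (1 + (PowerSeries.X ^ 3 + PowerSeries.X ^ 4) * onePlusW)) =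
      onePlusW ^ (x + 1) - onePlusW ^ x +
      (PowerSeries.X ^ 3 * onePlusW ^ (x + 2) - PowerSeries.X ^ 3 * onePlusW ^ (x + 1)) +
      (PowerSeries.X ^ 4 * onePlusW ^ (x + 2) - PowerSeries.X ^ 4 * onePlusW ^ (x + 1)) := by
    rw [hw]; ring
  have e2 : ballotKernel *
      (onePlusW ^ x * (1 + (PowerSeries.X ^ 3 + PowerSeries.X ^ 4) * onePlusW)) =
      onePlusW ^ (x + 2) + PowerSeries.X ^ 3 * onePlusW ^ (x + 3) := by
    rw [ballotKernel]
    linear_combination (onePlusW ^ (x + 2) * (1 + PowerSeries.X ^ 3 * onePlusW)) * mul_clusterInv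
  rw [e1, e2] at key
  simp only [lagrangeSum_add, lagrangeSum_sub, lagrangeSum_X_pow_mul] at key
  rw [key]
  ring

theorem lagrangeEntry_of_neg (φ H : PowerSeries (Polynomial ℚ)) (n : ℤ) (h : n < 0) :
    lagrangeEntry φ H n = 0 := if_pos h

theorem lagrangeEntry_recurrence (n : ℤ) (x : ℕ) :
    lagrangeEntry ballotKernel (onePlusW ^ (x + 1)) n -
      lagrangeEntry ballotKernel (onePlusW ^ x) n +
      (lagrangeEntry ballotKernel (onePlusW ^ (x + 2)) (n - 3) -
        lagrangeEntry ballotKernel (onePlusW ^ (x + 1)) (n - 3)) +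
      (lagrangeEntry ballotKernel (onePlusW ^ (x + 2)) (n - 4) -
        lagrangeEntry ballotKernel (onePlusW ^ (x + 1)) (n - 4)) =
    lagrangeEntry ballotKernel (onePlusW ^ (x + 2)) (n - 1) +
      lagrangeEntry ballotKernel (onePlusW ^ (x + 3)) (n - 4) := by
  by_cases hn : n < 0
  · simp only [lagrangeEntry_of_neg _ _ n hn, lagrangeEntry_of_neg _ _ (n - 1) (by omega),
      lagrangeEntry_of_neg _ _ (n - 3) (by omega), lagrangeEntry_of_neg _ _ (n - 4) (by omega)]
    norm_num
  · obtain ⟨n, rfl⟩ := Int.eq_ofNat_of_zero_le (not_lt.1 hn)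
    have key := congrArg (PowerSeries.coeff n) (lagrangeSum_ballotKernel_recurrence n x)
    have h0 (H : PowerSeries (Polynomial ℚ)) :
        PowerSeries.coeff n (lagrangeSum ballotKernel (n + 1) H) =
          lagrangeEntry ballotKernel H n := by
      simpa using coeff_X_pow_mul_lagrangeSum ballotKernel H (n + 1) n 0 (by omega)
    simp only [map_add, map_sub, h0] at key
    simp only [coeff_X_pow_mul_lagrangeSum ballotKernel _ (n + 1) n 3 (by omega),
      coeff_X_pow_mul_lagrangeSum ballotKernel _ (n + 1) n 4 (by omega),
      coeff_X_pow_mul_lagrangeSum ballotKernel _ n n 4 (by omega),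
      coeff_X_pow_mul_lagrangeSum ballotKernel _ n n 1 (by omega)] at key
    exact_mod_cast key

/-- The coefficient `(-1) ^ k * C(i + k - 1, k)` of `y ^ k` in `(1 + y) ^ (-i)`. -/
def negChoose (i k : ℕ) : ℚ := (-1 : ℚ) ^ k * ((i + k - 1).choose k : ℚ)

theorem negChoose_zero_right (i : ℕ) : negChoose i 0 = 1 := by simp [negChoose]

theorem negChoose_succ_succ (i k : ℕ) :
    negChoose (i + 1) (k + 1) + negChoose (i + 1) k = negChoose i (k + 1) := by
  have h : (i + k + 1).choose (k + 1) = (i + k).choose k + (i + k).choose (k + 1) :=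
    Nat.choose_succ_succ _ _
  have e1 : i + 1 + (k + 1) - 1 = i + k + 1 := by omega
  have e2 : i + 1 + k - 1 = i + k := by omega
  have e3 : i + (k + 1) - 1 = i + k := by omega
  rw [negChoose, negChoose, negChoose, e1, e2, e3, h, pow_succ]
  push_cast
  ring

theorem negChoose_zero_succ (k : ℕ) : negChoose 0 (k + 1) = 0 := by
  simp [negChoose]

theorem one_add_mul_sum_negChoose {R : Type*} [CommRing R] [Algebra ℚ R] (y : R) (i K : ℕ) :
    (1 + y) * ∑ k ∈ Finset.range (K + 1), negChoose (i + 1) k • y ^ k =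
      (∑ k ∈ Finset.range (K + 1), negChoose i k • y ^ k) +
        negChoose (i + 1) K • y ^ (K + 1) := by
  induction K with
  | zero => simp [negChoose_zero_right]
  | succ K ih =>
    rw [Finset.sum_range_succ, mul_add, ih, Finset.sum_range_succ _ (K + 1),
      ← negChoose_succ_succ i K]
    simp only [Algebra.smul_def, map_add]
    ring

theorem X_pow_dvd_clusterInv_pow_sub (i K : ℕ) :
    (PowerSeries.X ^ (K + 1) : PowerSeries (Polynomial ℚ)) ∣ clusterInv ^ i -
      ∑ k ∈ Finset.range (K + 1),
        negChoose i k • ((PowerSeries.X ^ 3 + PowerSeries.X ^ 4) * onePlusW) ^ k := by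
  induction i with
  | zero =>
    rw [Finset.sum_range_succ']
    simp [negChoose_zero_succ, negChoose_zero_right]
  | succ i ih =>
    set y : PowerSeries (Polynomial ℚ) := (PowerSeries.X ^ 3 + PowerSeries.X ^ 4) * onePlusW
      with hy
    have hinv : (1 + y) * clusterInv = 1 := mul_clusterInv
    have hsum := one_add_mul_sum_negChoose y i K
    have hdvd : (PowerSeries.X ^ (K + 1) : PowerSeries (Polynomial ℚ)) ∣
        negChoose (i + 1) K • y ^ (K + 1) := by
      rw [Algebra.smul_def]
      refine Dvd.dvd.mul_left (pow_dvd_pow_of_dvd ?_ _) _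
      exact ⟨(PowerSeries.X ^ 2 + PowerSeries.X ^ 3) * onePlusW, by rw [hy]; ring⟩
    have e : clusterInv ^ (i + 1) -
        ∑ k ∈ Finset.range (K + 1), negChoose (i + 1) k • y ^ k =
        clusterInv * ((clusterInv ^ i - ∑ k ∈ Finset.range (K + 1), negChoose i k • y ^ k) -
          negChoose (i + 1) K • y ^ (K + 1)) := by
      linear_combination (∑ k ∈ Finset.range (K + 1), negChoose (i + 1) k • y ^ k) * hinv -
        clusterInv * hsum
    rw [e]
    exact (dvd_sub ih hdvd).mul_left _

/-- The operator extracting `i` times the `i`-th Lagrange coefficient of `(1 + w) ^ x` from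
`φ ^ i`. -/
noncomputable def powerFunctional (x i : ℕ) : PowerSeries (Polynomial ℚ) →ₗ[ℚ] PowerSeries ℚ where
  toFun f := coeffSlice i
    (onePlusW ^ x * ((i : ℚ) • f - PowerSeries.C Polynomial.X * coeffDerivation f))
  map_add' f g := by
    rw [← map_add]
    congr 1
    simp only [map_add, smul_add]
    ring
  map_smul' c f := by
    rw [RingHom.id_apply, ← map_smul]
    congr 1
    rw [Derivation.map_smul]
    simp only [Algebra.smul_def]
    ring

theorem powerFunctional_apply (x i : ℕ) (f : PowerSeries (Polynomial ℚ)) :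
    powerFunctional x i f = coeffSlice i
      (onePlusW ^ x * ((i : ℚ) • f - PowerSeries.C Polynomial.X * coeffDerivation f)) := rfl

theorem coeffDerivation_X_pow_mul (a : ℕ) (f : PowerSeries (Polynomial ℚ)) :
    coeffDerivation (PowerSeries.X ^ a * f) = PowerSeries.X ^ a * coeffDerivation f := by
  simp [Derivation.leibniz, Derivation.leibniz_pow, coeffDerivation_X]

theorem powerFunctional_X_pow_mul (x i a : ℕ) (f : PowerSeries (Polynomial ℚ)) :
    powerFunctional x i (PowerSeries.X ^ a * f) = PowerSeries.X ^ a * powerFunctional x i f := by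
  rw [powerFunctional_apply, powerFunctional_apply, ← coeffSlice_X_pow_mul,
    coeffDerivation_X_pow_mul]
  congr 1
  simp only [Algebra.smul_def]
  ring

theorem powerFunctional_cluster_pow_mul (x i k : ℕ) (f : PowerSeries (Polynomial ℚ)) :
    powerFunctional x i ((PowerSeries.X ^ 3 + PowerSeries.X ^ 4) ^ k * f) =
      (PowerSeries.X ^ 3 + PowerSeries.X ^ 4) ^ k * powerFunctional x i f := by
  induction k generalizing f with
  | zero => simp
  | succ k ih =>
    rw [pow_succ, mul_assoc, ih, add_mul, map_add, powerFunctional_X_pow_mul,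
      powerFunctional_X_pow_mul, pow_succ]
    ring

theorem powerFunctional_onePlusW_pow (x i N : ℕ) :
    powerFunctional x (i + 1) (onePlusW ^ (N + 1)) =
      PowerSeries.C ((x : ℚ) * ((x + N).choose i : ℚ)) := by
  have h1 : coeffDerivation (onePlusW ^ (N + 1)) =
      PowerSeries.C (((N + 1 : ℕ) : Polynomial ℚ) * (1 + Polynomial.X) ^ N) := by
    rw [onePlusW, ← map_pow, coeffDerivation_C]
    simp [Polynomial.derivative_pow]
  have h2 : onePlusW ^ x * (((i + 1 : ℕ) : ℚ) • onePlusW ^ (N + 1) -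
      PowerSeries.C Polynomial.X * coeffDerivation (onePlusW ^ (N + 1))) =
      PowerSeries.C (((i + 1 : ℕ) : Polynomial ℚ) * (1 + Polynomial.X) ^ (x + N + 1) -
        Polynomial.X * (((N + 1 : ℕ) : Polynomial ℚ) * (1 + Polynomial.X) ^ (x + N))) := by
    rw [h1, Nat.cast_smul_eq_nsmul, nsmul_eq_mul, onePlusW]
    simp only [map_sub, map_mul, map_pow, map_natCast]
    ring
  have h3 : (((x + N).choose i : ℕ) : ℚ) * ((x + N + 1 : ℕ) : ℚ) =
      ((x + N + 1).choose (i + 1) : ℚ) * ((i + 1 : ℕ) : ℚ) := by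
    have := Nat.add_one_mul_choose_eq (x + N) i
    rw [mul_comm]
    exact_mod_cast this
  rw [powerFunctional_apply, h2, coeffSlice_C, Polynomial.coeff_sub, Polynomial.coeff_X_mul,
    Polynomial.coeff_natCast_mul, Polynomial.coeff_natCast_mul, Polynomial.coeff_one_add_X_pow,
    Polynomial.coeff_one_add_X_pow]
  congr 1
  push_cast at h3 ⊢
  linear_combination -h3

theorem X_pow_dvd_ballotKernel_pow_sub (i K : ℕ) :
    (PowerSeries.X ^ (K + 1) : PowerSeries (Polynomial ℚ)) ∣ ballotKernel ^ i -
      ∑ j ∈ Finset.range (i + 1), ∑ k ∈ Finset.range (K + 1),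
        ((i.choose j : ℚ) * negChoose i k) • (PowerSeries.X ^ (3 * j) *
          ((PowerSeries.X ^ 3 + PowerSeries.X ^ 4) ^ k * onePlusW ^ (2 * i + j + k))) := by
  have e : ∑ j ∈ Finset.range (i + 1), ∑ k ∈ Finset.range (K + 1),
        ((i.choose j : ℚ) * negChoose i k) • (PowerSeries.X ^ (3 * j) *
          ((PowerSeries.X ^ 3 + PowerSeries.X ^ 4) ^ k * onePlusW ^ (2 * i + j + k))) =
      onePlusW ^ (2 * i) * (1 + PowerSeries.X ^ 3 * onePlusW) ^ i *
        ∑ k ∈ Finset.range (K + 1),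
          negChoose i k • ((PowerSeries.X ^ 3 + PowerSeries.X ^ 4) * onePlusW) ^ k := by
    rw [add_comm (1 : PowerSeries (Polynomial ℚ)), add_pow, mul_assoc, Finset.sum_mul_sum,
      Finset.mul_sum]
    refine Finset.sum_congr rfl fun j _ => ?_
    rw [Finset.mul_sum]
    refine Finset.sum_congr rfl fun k _ => ?_
    simp only [Algebra.smul_def, map_mul, map_natCast, one_pow, mul_pow _ onePlusW]
    ring
  rw [e, ballotKernel, mul_pow, mul_pow, ← pow_mul, ← mul_sub]
  exact (X_pow_dvd_clusterInv_pow_sub i K).mul_left _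

theorem coeff_X_pow_mul_cluster_pow (n j k : ℕ) (c : ℚ) :
    PowerSeries.coeff n (PowerSeries.X ^ (3 * j) *
      ((PowerSeries.X ^ 3 + PowerSeries.X ^ 4) ^ k * PowerSeries.C c)) =
      (if 3 * j + 3 * k ≤ n then (k.choose (n - 3 * j - 3 * k) : ℚ) else 0) * c := by
  have e : (PowerSeries.X ^ (3 * j) *
      ((PowerSeries.X ^ 3 + PowerSeries.X ^ 4) ^ k * PowerSeries.C c) : PowerSeries ℚ) =
      PowerSeries.X ^ (3 * j + 3 * k) *
        (((1 + Polynomial.X) ^ k : Polynomial ℚ) : PowerSeries ℚ) * PowerSeries.C c := by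
    push_cast
    have : (PowerSeries.X ^ 3 + PowerSeries.X ^ 4 : PowerSeries ℚ) =
      PowerSeries.X ^ 3 * (1 + PowerSeries.X) := by ring
    rw [this, mul_pow]
    ring
  rw [e, PowerSeries.coeff_mul_C, PowerSeries.coeff_X_pow_mul']
  split_ifs
  · rw [Polynomial.coeff_coe, Polynomial.coeff_one_add_X_pow, Nat.sub_sub]
  · rfl

theorem coeff_lagrangeCoeff_succ (x i n K : ℕ) (hn : n ≤ K) :
    ((i : ℚ) + 1) *
      PowerSeries.coeff n (lagrangeCoeff ballotKernel (onePlusW ^ x) (i + 1)) =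
      ∑ j ∈ Finset.range (i + 2), ∑ k ∈ Finset.range (K + 1),
        (((i + 1).choose j : ℚ) * negChoose (i + 1) k) *
          ((if 3 * j + 3 * k ≤ n then (k.choose (n - 3 * j - 3 * k) : ℚ) else 0) *
            ((x : ℚ) * ((x + (2 * i + 1 + j + k)).choose i : ℚ))) := by
  obtain ⟨R, hR⟩ := X_pow_dvd_ballotKernel_pow_sub (i + 1) K
  have hL := lagrangeCoeff_succ ballotKernel (onePlusW ^ x) i
  have hcast : (i : ℚ) + 1 = ((i + 1 : ℕ) : ℚ) := by push_cast; rfl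
  rw [hcast, ← powerFunctional_apply, sub_eq_iff_eq_add.1 hR, map_add,
    powerFunctional_X_pow_mul] at hL
  have hc := congrArg (PowerSeries.coeff n) hL
  rw [map_add, PowerSeries.coeff_X_pow_mul', if_neg (by omega), zero_add, PowerSeries.coeff_smul,
    smul_eq_mul, ← hcast] at hc
  rw [hc]
  simp only [map_sum, map_smul, smul_eq_mul]
  refine Finset.sum_congr rfl fun j _ => Finset.sum_congr rfl fun k _ => ?_
  have e : 2 * (i + 1) + j + k = 2 * i + 1 + j + k + 1 := by ring
  rw [powerFunctional_X_pow_mul, powerFunctional_cluster_pow_mul, e,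
    powerFunctional_onePlusW_pow, coeff_X_pow_mul_cluster_pow]

theorem choose_div_eq (d i l : ℕ) :
    ((i : ℚ) + 1) * ((1 / ((d : ℚ) + ((i + 1 : ℕ) : ℚ) + l + 1)) *
      ((d + 2 * (i + 1) + l).choose (i + 1) : ℚ)) =
      ((d + 2 * (i + 1) + l).choose i : ℚ) := by
  have h := Nat.choose_succ_right_eq (d + 2 * (i + 1) + l) i
  have e : d + 2 * (i + 1) + l - i = d + (i + 1) + l + 1 := by omega
  rw [e] at h
  have hq : ((d + 2 * (i + 1) + l).choose (i + 1) : ℚ) * ((i : ℚ) + 1) =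
      ((d + 2 * (i + 1) + l).choose i : ℚ) * ((d : ℚ) + ((i + 1 : ℕ) : ℚ) + l + 1) := by
    exact_mod_cast h
  have hpos : (d : ℚ) + ((i + 1 : ℕ) : ℚ) + l + 1 ≠ 0 := by positivity
  field_simp
  linear_combination hq

theorem coeff_lagrangeCoeff_eq (d i n : ℕ) (hi : i ≤ n) :
    PowerSeries.coeff (n - i) (lagrangeCoeff ballotKernel (onePlusW ^ (d + 1)) i) =
      ∑ j ∈ Finset.range (n + 1), ∑ k ∈ Finset.range (n + 1),
        ((d : ℚ) + 1) * ((i.choose j : ℚ) * negChoose i k *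
          (if i + 3 * j + 3 * k ≤ n then (k.choose (n - i - 3 * j - 3 * k) : ℚ) else 0) *
          (1 / ((d : ℚ) + i + j + k + 1)) * ((d + 2 * i + j + k).choose i : ℚ)) := by
  cases i with
  | zero =>
    rw [Finset.sum_range_succ', Finset.sum_range_succ', Finset.sum_eq_zero, Finset.sum_eq_zero]
    · have hd : (d : ℚ) + 1 ≠ 0 := by positivity
      rw [lagrangeCoeff, onePlusW, ← map_pow, coeffSlice_C, PowerSeries.coeff_C]
      rcases n with _ | n <;> simp [negChoose, Polynomial.coeff_one_add_X_pow, hd]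
    · intro k _
      simp [negChoose_zero_succ]
    · intro j _
      simp
  | succ i =>
    have hi0 : (i : ℚ) + 1 ≠ 0 := by positivity
    apply mul_left_cancel₀ hi0
    rw [coeff_lagrangeCoeff_succ (d + 1) i (n - (i + 1)) n (by omega), Finset.mul_sum]
    have hsub : Finset.range (i + 2) ⊆ Finset.range (n + 1) :=
      Finset.range_subset_range.2 (by omega)
    rw [← Finset.sum_subset hsub]
    · refine Finset.sum_congr rfl fun j _ => ?_
      rw [Finset.mul_sum]
      refine Finset.sum_congr rfl fun k _ => ?_
      have hc := choose_div_eq d i (j + k)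
      have e1 : d + 1 + (2 * i + 1 + j + k) = d + 2 * (i + 1) + (j + k) := by ring
      have e2 : d + 2 * (i + 1) + j + k = d + 2 * (i + 1) + (j + k) := by ring
      have e3 : (3 * j + 3 * k ≤ n - (i + 1)) ↔ (i + 1 + 3 * j + 3 * k ≤ n) := by omega
      have e4 : (d : ℚ) + ((i + 1 : ℕ) : ℚ) + j + k + 1 =
        (d : ℚ) + ((i + 1 : ℕ) : ℚ) + ((j + k : ℕ) : ℚ) + 1 := by push_cast; ring
      rw [e1, e2, e4, ← hc]
      simp only [e3]
      push_cast
      ring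
    · intro j _ hj
      rw [Nat.choose_eq_zero_of_lt (by simp only [Finset.mem_range] at hj; omega)]
      simp

theorem diagCount_eq_lagrangeEntry (n : ℤ) (x : ℕ) :
    diagCount n x = lagrangeEntry ballotKernel (onePlusW ^ x) n := by
  refine eq_of_diag_recurrence diagCount (fun n x => lagrangeEntry ballotKernel (onePlusW ^ x) n)
    diagCount_recurrence lagrangeEntry_recurrence
    (fun n x h => by rw [diagCount_of_neg n x h, lagrangeEntry_of_neg _ _ _ h]) (fun n => ?_) n x
  rw [diagCount_zero, lagrangeEntry]
  by_cases hn : n < 0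
  · rw [if_neg (by omega), if_pos hn]
  · obtain ⟨n, rfl⟩ := Int.eq_ofNat_of_zero_le (not_lt.1 hn)
    rw [if_neg hn, Int.toNat_natCast, coeff_lagrangeSum _ _ _ _ le_rfl,
      Finset.sum_range_succ', Finset.sum_eq_zero]
    · have h1 : (1 : PowerSeries (Polynomial ℚ)) = PowerSeries.C 1 := by simp
      rw [pow_zero, lagrangeCoeff, h1, coeffSlice_C, PowerSeries.coeff_C]
      simp
    · intro i hi
      have hi' : (i : ℚ) + 1 ≠ 0 := by positivity
      apply mul_left_cancel₀ hi'
      rw [coeff_lagrangeCoeff_succ 0 i _ n (by omega)]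
      simp

/-- Explicit formula for ballot paths avoiding `rururrur` (depth-zero, dimensions `5 × 3`,
with exactly the two bifixes `rur` and `r`): for `m ≥ n ≥ 0`,
`s p n m = (m-n+1) ∑_{i=0}^{n} ∑_{j≥0} ∑_{k≥0} C(i,j) G(-i,k) C(k, n-i-3j-3k)
  (1/(m-n+i+j+k+1)) C(m-n+2i+j+k, i)`,
where `G(-i,k) = (-1)^k C(i+k-1, k)` and `C(x,y) = 0` for `y < 0`. -/
theorem ballot_avoiding_rururrur_formula (n m : ℕ) (hnm : n ≤ m) :
    (s rururrur n m : ℚ) = ((m : ℚ) - n + 1) *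
      ∑ i ∈ Finset.range (n + 1), ∑ j ∈ Finset.range (n + 1),
        ∑ k ∈ Finset.range (n + 1),
          (Nat.choose i j : ℚ) *
            ((-1 : ℚ) ^ k * (Nat.choose (i + k - 1) k : ℚ)) *
            (if i + 3 * j + 3 * k ≤ n then (Nat.choose k (n - i - 3 * j - 3 * k) : ℚ)
              else 0) *
            (1 / ((m : ℚ) - n + i + j + k + 1)) *
            (Nat.choose (m - n + 2 * i + j + k) i : ℚ) := by
  obtain ⟨d, rfl⟩ := Nat.exists_eq_add_of_le hnm
  have hs : (s rururrur n (n + d : ℕ) : ℚ) = diagCount n (d + 1) := by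
    rw [diagCount, if_neg (by omega), add_zero]
    congr 2
    push_cast
    ring
  have hd : ((n + d : ℕ) : ℚ) - n = d := by push_cast; ring
  rw [hs, diagCount_eq_lagrangeEntry, lagrangeEntry, if_neg (by omega), Int.toNat_natCast,
    coeff_lagrangeSum _ _ _ _ le_rfl, hd, Nat.add_sub_cancel_left, Finset.mul_sum]
  refine Finset.sum_congr rfl fun i hi => ?_
  rw [coeff_lagrangeCoeff_eq d i n (by simpa [Nat.lt_succ_iff] using hi), Finset.mul_sum]
  refine Finset.sum_congr rfl fun j _ => ?_
  rw [Finset.mul_sum]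
  rfl
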